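/- Let A be a C*-algebra and let (A_λ)_{λ∈Λ} be a family of C*-subalgebras of A, each of which is soft, such that A is approximated by the family (A_λ): for every finite collection a₁, …, aₙ ∈ A and every ε > 0 there exist λ ∈ Λ and b₁, …, bₙ ∈ A_λ with ‖aⱼ − bⱼ‖ < ε for j = 1, …, n. Then A is soft. -/

import Mathlib

/-!
Common definitions: softness for (non-unital) C*-algebras.

A C*-algebra is *soft* if it has no nonzero unital quotient; equivalently, for every
closed two-sided ideal `I` with `A/I ≠ 0`, the quotient `A/I` is not unital.
We encode properties of the quotient `A/I` intrinsically in `A`.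
-/

variable {A : Type*}

/-- The quotient of `A` by the two-sided ideal `I` is unital: some `e ∈ A` represents
a multiplicative unit of `A/I`. -/
def QuotUnital [NonUnitalNonAssocRing A] (I : TwoSidedIdeal A) : Prop :=
  ∃ e : A, ∀ x : A, x * e - x ∈ I ∧ e * x - x ∈ I

/-- The quotient of `A` by the two-sided ideal `I` is nonzero. -/
def QuotNonzero [NonUnitalNonAssocRing A] (I : TwoSidedIdeal A) : Prop :=
  ∃ x : A, x ∉ I

/-- A C*-algebra is *soft* if it has no nonzero unital quotient. -/
def IsSoftCStar (A : Type*) [NonUnitalNonAssocRing A] [TopologicalSpace A] : Prop :=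
  ∀ I : TwoSidedIdeal A, IsClosed (I : Set A) → QuotNonzero I → ¬ QuotUnital I

/-- A closed two-sided ideal of a C*-algebra is closed under the involution. -/
theorem TwoSidedIdeal.star_mem_of_isClosed [NonUnitalCStarAlgebra A] {I : TwoSidedIdeal A}
    (hI : IsClosed (I : Set A)) {x : A} (hx : x ∈ I) : star x ∈ I := by
  have hmem : star x ∈ closure (I : Set A) := by
    rw [Metric.mem_closure_iff]
    intro δ hδ
    obtain ⟨ε, hε, hεδ⟩ : ∃ ε : ℝ, 0 < ε ∧ ε < δ ^ 2 :=
      ⟨δ ^ 2 / 2, by positivity, half_lt_self (by positivity)⟩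
    have hpos (t : ℝ) : 0 < ε ^ 2 + t ^ 2 := by positivity
    have hne (t : ℝ) : ε ^ 2 + t ^ 2 ≠ 0 := (hpos t).ne'
    set h : A := star x * x with hh
    have hsa : IsSelfAdjoint h := .star_mul_self x
    set q : ℝ → ℝ := fun t ↦ t / (ε ^ 2 + t ^ 2) with hq
    have hqc : Continuous q := by fun_prop (disch := exact hne _)
    have hq0 : q 0 = 0 := by simp [hq]
    set s : A := cfcₙ (fun t ↦ t * q t) h with hs
    have hs_star : star s = s := (cfcₙ_predicate _ h : IsSelfAdjoint s)
    have hs_mul : s = h * cfcₙ q h := by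
      rw [hs, cfcₙ_mul (fun t ↦ t) q h, cfcₙ_id' ℝ h]
    have hsI : s ∈ I := hs_mul ▸ I.mul_mem_right _ _ (I.mul_mem_left _ _ hx)
    refine ⟨s * star x, I.mul_mem_right _ _ hsI, ?_⟩
    have hprod : (star x - s * star x) * star (star x - s * star x) =
        cfcₙ (fun t ↦ (t - t * q t * t) - (t - t * q t * t) * (t * q t)) h := by
      rw [cfcₙ_sub (fun t ↦ t - t * q t * t) (fun t ↦ (t - t * q t * t) * (t * q t)) h,
        cfcₙ_mul (fun t ↦ t - t * q t * t) (fun t ↦ t * q t) h,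
        cfcₙ_sub (fun t ↦ t) (fun t ↦ t * q t * t) h,
        cfcₙ_mul (fun t ↦ t * q t) (fun t ↦ t) h, cfcₙ_id' ℝ h, ← hs]
      simp only [star_sub, star_mul, star_star, hs_star, hh]
      noncomm_ring
    have hnorm : ‖star x - s * star x‖ * ‖star x - s * star x‖ ≤ ε := by
      rw [← CStarRing.norm_self_mul_star, hprod]
      refine norm_cfcₙ_le fun t _ ↦ ?_
      have hu : (t - t * q t * t) - (t - t * q t * t) * (t * q t) =
          t * (ε ^ 2 / (ε ^ 2 + t ^ 2)) ^ 2 := by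
        have := hne t
        simp only [hq]
        field_simp
        ring
      have h1 : ε ^ 2 / (ε ^ 2 + t ^ 2) ≤ 1 := by
        rw [div_le_one (hpos t)]; nlinarith [sq_nonneg t]
      have h0 : 0 ≤ ε ^ 2 / (ε ^ 2 + t ^ 2) := by positivity
      have h2 : |t| * (ε ^ 2 / (ε ^ 2 + t ^ 2)) ≤ ε := by
        rw [← mul_div_assoc, div_le_iff₀ (hpos t)]
        have : |t| * ε ≤ ε ^ 2 + t ^ 2 := by
          nlinarith [sq_nonneg (|t| - ε), sq_abs t, abs_nonneg t]
        nlinarith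
      rw [hu, Real.norm_eq_abs, abs_mul, abs_pow, abs_of_nonneg h0, sq, ← mul_assoc]
      calc _ ≤ ε * 1 := mul_le_mul h2 h1 h0 hε.le
        _ = ε := mul_one ε
    rw [dist_eq_norm]
    nlinarith [norm_nonneg (star x - s * star x)]
  rwa [hI.closure_eq] at hmem

/-- If each term of a sequence is, modulo a closed ideal, the next one times `c`, and the terms
grow slower than the powers of `‖c‖` decay, then the first term lies in the ideal. -/
theorem TwoSidedIdeal.mem_of_forall_sub_mul_mem [NonUnitalNormedRing A] {I : TwoSidedIdeal A}
    (hI : IsClosed (I : Set A)) {c : A} {k : ℕ → A} {C r s : ℝ} (hr : ‖c‖ ≤ r) (hs : 0 ≤ s)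
    (hrs : r * s < 1) (hk : ∀ n, ‖k n‖ ≤ C * s ^ n) (hkI : ∀ n, k n - k (n + 1) * c ∈ I) :
    k 0 ∈ I := by
  have hr0 : 0 ≤ r := (norm_nonneg c).trans hr
  have key (n : ℕ) : ∀ j, ∃ y, k j - y ∈ I ∧ ‖y‖ ≤ r ^ n * ‖k (j + n)‖ := by
    induction n with
    | zero => exact fun j ↦ ⟨k j, by simp, by simp⟩
    | succ n ih =>
      intro j
      obtain ⟨y, hy, hyn⟩ := ih (j + 1)
      refine ⟨y * c, ?_, ?_⟩
      · have := I.add_mem (hkI j) (I.mul_mem_right _ c hy)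
        rwa [sub_mul, sub_add_sub_cancel] at this
      · calc ‖y * c‖ ≤ ‖y‖ * ‖c‖ := norm_mul_le _ _
          _ ≤ (r ^ n * ‖k (j + 1 + n)‖) * r := by gcongr
          _ = r ^ (n + 1) * ‖k (j + (n + 1))‖ := by
            rw [show j + 1 + n = j + (n + 1) by ring]; ring
  choose y hyI hy using fun n ↦ key n 0
  have hlim : Filter.Tendsto (fun n ↦ C * (r * s) ^ n) Filter.atTop (nhds 0) := by
    simpa using (tendsto_pow_atTop_nhds_zero_of_lt_one (by positivity) hrs).const_mul C
  have hy0 : Filter.Tendsto y Filter.atTop (nhds 0) := by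
    refine squeeze_zero_norm (fun n ↦ (hy n).trans ?_) hlim
    calc r ^ n * ‖k (0 + n)‖ ≤ r ^ n * (C * s ^ n) := by
          rw [zero_add]; gcongr; exact hk n
      _ = C * (r * s) ^ n := by rw [mul_pow]; ring
  refine hI.mem_of_tendsto (f := fun n ↦ k 0 - y n) (b := Filter.atTop) ?_ (.of_forall hyI)
  simpa using hy0.const_sub (k 0)

/-- There are a continuous function `w` equal to `1` at `0` and vanishing near `1`, and a bounded
continuous function `ρ` inverting `1 - t` on the support of `w`. -/
theorem exists_continuous_cutoff_inv_one_sub : ∃ w ρ : ℝ → ℝ, Continuous w ∧ Continuous ρ ∧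
    w 0 = 1 ∧ (∀ t, |w t| ≤ 1) ∧ (∀ t, |ρ t| ≤ 2) ∧ ∀ t, w t * (ρ t * (1 - t)) = w t := by
  set w : ℝ → ℝ := fun t ↦ min 1 (max 0 (2 * |1 - t| - 1)) with hw
  set ρ : ℝ → ℝ := fun t ↦ (1 - t) / max (1 / 4) ((1 - t) ^ 2) with hρ
  have hmax (t : ℝ) : 0 < max (1 / 4 : ℝ) ((1 - t) ^ 2) := lt_max_of_lt_left (by norm_num)
  have hwc : Continuous w := by fun_prop
  have hρc : Continuous ρ :=
    .div (by fun_prop) (by fun_prop) fun t ↦ (hmax t).ne'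
  have hw_abs (t : ℝ) : |w t| ≤ 1 := by
    rw [abs_of_nonneg (le_min zero_le_one (le_max_left _ _))]
    exact min_le_left _ _
  have hρ_abs (t : ℝ) : |ρ t| ≤ 2 := by
    rw [hρ, abs_div, abs_of_pos (hmax t), div_le_iff₀ (hmax t)]
    rcases le_total |1 - t| (1 / 2) with h | h
    · linarith [le_max_left (1 / 4 : ℝ) ((1 - t) ^ 2)]
    · nlinarith [le_max_right (1 / 4 : ℝ) ((1 - t) ^ 2), sq_abs (1 - t)]
  have hwρ (t : ℝ) : w t * (ρ t * (1 - t)) = w t := by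
    rcases le_total |1 - t| (1 / 2) with h | h
    · have : w t = 0 := by
        rw [hw]
        simp only
        rw [max_eq_left (by linarith), min_eq_right zero_le_one]
      simp [this]
    · have h4 : 1 / 4 ≤ (1 - t) ^ 2 := by nlinarith [sq_abs (1 - t)]
      have : ρ t * (1 - t) = 1 := by
        rw [hρ]
        simp only
        rw [max_eq_right h4, div_mul_eq_mul_div, ← sq, div_self (by linarith)]
      rw [this, mul_one]
  exact ⟨w, ρ, hwc, hρc, by norm_num [hw], hw_abs, hρ_abs, hwρ⟩

/-- If a self-adjoint element `b` is close to an element `p` that represents a right unit of the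
quotient by a closed ideal, then some continuous function of `b` represents a right unit too. -/
theorem TwoSidedIdeal.exists_cfcₙ_right_unit [NonUnitalCStarAlgebra A] {I : TwoSidedIdeal A}
    (hI : IsClosed (I : Set A)) {p b : A} (hp : ∀ x, x * p - x ∈ I) (hb : IsSelfAdjoint b)
    (hpb : ‖p - b‖ ≤ 1 / 4) : ∃ f : ℝ → ℝ, ∀ x, x * cfcₙ f b - x ∈ I := by
  obtain ⟨w, ρ, hwc, hρc, hw0, hw_abs, hρ_abs, hwρ⟩ := exists_continuous_cutoff_inv_one_sub
  have hbI : cfcₙ (fun t ↦ t * w t) b ∈ I := by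
    have := I.mem_of_forall_sub_mul_mem hI (c := p - b)
      (k := fun n ↦ cfcₙ (fun t ↦ t * w t * ρ t ^ n) b) (C := ‖b‖) hpb zero_le_two (by norm_num)
      (fun n ↦ norm_cfcₙ_le fun t ht ↦ ?_) fun n ↦ ?_
    · simpa using this
    · have htb : |t| ≤ ‖b‖ := by
        simpa [cfcₙ_id' ℝ b] using norm_apply_le_norm_cfcₙ (fun t : ℝ ↦ t) b ht
      rw [Real.norm_eq_abs, abs_mul, abs_mul, abs_pow]
      calc |t| * |w t| * |ρ t| ^ n ≤ ‖b‖ * 1 * 2 ^ n := by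
            gcongr
            exacts [hw_abs t, hρ_abs t]
        _ = ‖b‖ * 2 ^ n := by rw [mul_one]
    · have hstep : cfcₙ (fun t ↦ t * w t * ρ t ^ n) b =
          cfcₙ (fun t ↦ t * w t * ρ t ^ (n + 1)) b -
            cfcₙ (fun t ↦ t * w t * ρ t ^ (n + 1)) b * b := by
        conv_rhs =>
          enter [2, 2]
          rw [← cfcₙ_id' ℝ b]
        rw [← cfcₙ_mul (fun t ↦ t * w t * ρ t ^ (n + 1)) (fun t ↦ t) b,
          ← cfcₙ_sub (fun t ↦ t * w t * ρ t ^ (n + 1)) (fun t ↦ t * w t * ρ t ^ (n + 1) * t) b]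
        congr 1
        ext t
        linear_combination (-t * ρ t ^ n) * hwρ t
      have := I.neg_mem (hp (cfcₙ (fun t ↦ t * w t * ρ t ^ (n + 1)) b))
      rw [hstep]
      convert this using 1
      noncomm_ring
  refine ⟨fun t ↦ 1 - w t, fun x ↦ ?_⟩
  set u := cfcₙ (fun t ↦ 1 - w t) b with hu
  have hub : u * b - b = - cfcₙ (fun t ↦ t * w t) b := by
    have h1 : cfcₙ (fun t ↦ t * w t) b = cfcₙ (fun t ↦ t - (1 - w t) * t) b := by
      congr 1
      ext t
      ring
    rw [h1, cfcₙ_sub (fun t ↦ t) (fun t ↦ (1 - w t) * t) b,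
      cfcₙ_mul (fun t ↦ 1 - w t) (fun t ↦ t) b (hf0 := by simp [hw0]), cfcₙ_id' ℝ b, ← hu]
    abel
  refine I.mem_of_forall_sub_mul_mem hI (c := p - b) (k := fun _ ↦ x * u - x)
    (C := ‖x * u - x‖) (s := 1) hpb zero_le_one (by norm_num) (by simp) fun _ ↦ ?_
  have h2 : x * (u * b - b) ∈ I := I.mul_mem_left _ _ (hub ▸ I.neg_mem hbI)
  have := I.sub_mem h2 (hp (x * u - x))
  convert this using 1
  noncomm_ring

/-- If `A` is approximated by a family of soft C*-subalgebras,
then `A` is soft. -/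
theorem isSoftCStar_of_approx [NonUnitalCStarAlgebra A] {Λ : Type*}
    (B : Λ → NonUnitalStarSubalgebra ℂ A)
    (hclosed : ∀ l : Λ, IsClosed (B l : Set A))
    (hsoft : ∀ l : Λ, IsSoftCStar (B l))
    (happrox : ∀ (n : ℕ) (a : Fin n → A) (ε : ℝ), 0 < ε →
      ∃ l : Λ, ∀ j : Fin n, ∃ b ∈ B l, ‖a j - b‖ < ε) :
    IsSoftCStar A := by
  rintro I hI ⟨x₀, hx₀⟩ ⟨e, he⟩
  have hstar {x : A} (hx : x ∈ I) : star x ∈ I := I.star_mem_of_isClosed hI hx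
  have hp (x : A) : x * (star e * e) - x ∈ I := by
    have h1 := (he (x * star e)).1
    have h2 := hstar (he (star x)).2
    rw [star_sub, star_mul, star_star] at h2
    have := I.add_mem h1 h2
    rwa [sub_add_sub_cancel, mul_assoc] at this
  obtain ⟨l, hl⟩ := happrox 1 (fun _ ↦ star e * e) (1 / 4) (by norm_num)
  obtain ⟨b₀, hb₀, hb₀n⟩ := hl 0
  set b : A := (1 / 2 : ℂ) • (b₀ + star b₀) with hb
  have hbB : b ∈ B l := SMulMemClass.smul_mem _ (add_mem hb₀ (star_mem hb₀))
  have hbsa : IsSelfAdjoint b := by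
    rw [IsSelfAdjoint, hb, star_smul, star_add, star_star, add_comm]
    simp
  have hpb : ‖star e * e - b‖ ≤ 1 / 4 := by
    have h1 : star e * e - b =
        (1 / 2 : ℂ) • ((star e * e - b₀) + star (star e * e - b₀)) := by
      rw [hb, star_sub, star_mul, star_star]
      module
    have h3 : ‖(1 / 2 : ℂ)‖ = 1 / 2 := by norm_num
    rw [h1, norm_smul, h3]
    have h2 := norm_add_le (star e * e - b₀) (star (star e * e - b₀))
    rw [norm_star] at h2
    linarith
  obtain ⟨f, hf⟩ := I.exists_cfcₙ_right_unit hI hp hbsa hpb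
  set u := cfcₙ f b with hu
  have := hclosed l
  have huB : u ∈ B l := cfcₙ_mem (𝕜' := ℂ) f hbB
  have hu_star : star u = u := (cfcₙ_predicate f b : IsSelfAdjoint u)
  have hf' (x : A) : u * x - x ∈ I := by
    simpa [hu_star] using hstar (hf (star x))
  refine hsoft l (I.comap (NonUnitalStarSubalgebraClass.subtype (B l))) ?_ ?_ ?_
  · have : ((I.comap (NonUnitalStarSubalgebraClass.subtype (B l)) : TwoSidedIdeal (B l)) :
        Set (B l)) = Subtype.val ⁻¹' (I : Set A) := by
      ext x
      exact TwoSidedIdeal.mem_comap _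
    rw [this]
    exact hI.preimage continuous_subtype_val
  · refine ⟨⟨u, huB⟩, fun hmem ↦ hx₀ ?_⟩
    have huI : u ∈ I := (TwoSidedIdeal.mem_comap _).1 hmem
    simpa using I.sub_mem (I.mul_mem_left x₀ u huI) (hf x₀)
  · exact ⟨⟨u, huB⟩, fun x ↦
      ⟨(TwoSidedIdeal.mem_comap _).2 (hf x), (TwoSidedIdeal.mem_comap _).2 (hf' x)⟩⟩
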